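/- arXiv:1809.09918 — 4 statements merged into one kernel-verified Lean document; each statement's English description precedes it below -/
import Mathlib

section
/- Let H be an n×n complex matrix and η an invertible Hermitian n×n complex matrix with H†η = ηH. Suppose there exists an invertible n×n complex matrix Ψ' such that Ψ'⁻¹HΨ' = J and Ψ'†ηΨ' = S, where S is Hermitian and satisfies S² = I. Then there exist invertible n×n complex matrices Ψ, Ξ, Σ and a Hermitian 2n×2n complex matrix H̃ such that, writing Ψ̃ for the 2n×n block matrix with top block Ψ and bottom block Ξ, and Φ̃ for the 2n×n block matrix with top block Ψ and bottom block Σ, the equations Φ̃†Ψ̃ = S and Φ̃†H̃Ψ̃ = SJ hold. -/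
open Matrix

/-- Let `H` be an `n × n` complex matrix and `η` an invertible Hermitian
matrix with `Hᴴ * η = η * H`.  Suppose there is an invertible matrix `Ψ'` with
`Ψ'⁻¹ * H * Ψ' = J` and `Ψ'ᴴ * η * Ψ' = S`, where `S` is Hermitian with `S * S = 1`.
Then there exist invertible matrices `Ψ, Ξ, Sgm` and a Hermitian `2n × 2n` matrix `H̃` such
that, with `Ψ̃ = fromRows Ψ Ξ` and `Φ̃ = fromRows Ψ Sgm`, one has `Φ̃ᴴ * Ψ̃ = S` and
`Φ̃ᴴ * H̃ * Ψ̃ = S * J`. -/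
theorem generalized_embedding_of_pseudoHermitian (n : ℕ)
    (H η J S : Matrix (Fin n) (Fin n) ℂ)
    (hη : η.IsHermitian) (hηinv : IsUnit η) (hpseudo : Hᴴ * η = η * H)
    (hS : S.IsHermitian) (hS2 : S * S = 1)
    (Ψ' : Matrix (Fin n) (Fin n) ℂ) (hΨ' : IsUnit Ψ')
    (hJ : Ψ'⁻¹ * H * Ψ' = J) (hSΨ' : Ψ'ᴴ * η * Ψ' = S) :
    ∃ (Ψ Ξ Sgm : Matrix (Fin n) (Fin n) ℂ)
      (H' : Matrix (Fin n ⊕ Fin n) (Fin n ⊕ Fin n) ℂ),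
      IsUnit Ψ ∧ IsUnit Ξ ∧ IsUnit Sgm ∧ H'.IsHermitian ∧
      (fromRows Ψ Sgm)ᴴ * fromRows Ψ Ξ = S ∧
      (fromRows Ψ Sgm)ᴴ * H' * fromRows Ψ Ξ = S * J := by
  have hdet : IsUnit Ψ'.det := (Matrix.isUnit_iff_isUnit_det _).1 hΨ'
  have hSJ : S * J = Ψ'ᴴ * (η * H) * Ψ' := by
    rw [← hSΨ', ← hJ]
    simp only [Matrix.mul_assoc]
    rw [Matrix.mul_nonsing_inv_cancel_left _ _ hdet]
  have hSJh : (S * J)ᴴ = S * J := by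
    rw [hSJ]
    simp only [conjTranspose_mul, conjTranspose_conjTranspose, hη.eq, hpseudo, Matrix.mul_assoc]
  have h2 : IsUnit ((2 : ℂ) • (1 : Matrix (Fin n) (Fin n) ℂ)) := by
    rw [Matrix.isUnit_iff_isUnit_det]
    simp
  have hX : IsUnit (S - (4 : ℂ) • (1 : Matrix (Fin n) (Fin n) ℂ)) := by
    rw [Matrix.isUnit_iff_isUnit_det]
    refine Matrix.isUnit_det_of_right_inverse
      (B := (-1 / 15 : ℂ) • (S + (4 : ℂ) • (1 : Matrix (Fin n) (Fin n) ℂ))) ?_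
    simp only [Matrix.mul_smul, Matrix.mul_add, Matrix.sub_mul, Matrix.smul_mul, hS2,
      Matrix.one_mul, Matrix.mul_one]
    module
  refine ⟨(2 : ℂ) • 1, S - (4 : ℂ) • 1, 1, fromBlocks ((1 / 4 : ℂ) • (S * J)) 0 0 0,
    h2, hX, isUnit_one, ?_, ?_, ?_⟩
  · rw [Matrix.IsHermitian, fromBlocks_conjTranspose, conjTranspose_smul, hSJh]
    simp
  · rw [conjTranspose_fromRows_eq_fromCols_conjTranspose, fromCols_mul_fromRows]
    simp only [conjTranspose_smul, conjTranspose_one, Matrix.smul_mul, Matrix.one_mul, star_ofNat]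
    module
  · rw [conjTranspose_fromRows_eq_fromCols_conjTranspose, fromCols_mul_fromBlocks,
      fromCols_mul_fromRows]
    simp only [conjTranspose_smul, conjTranspose_one, Matrix.smul_mul, Matrix.one_mul, star_ofNat,
      Matrix.mul_smul, Matrix.mul_zero, Matrix.zero_mul, Matrix.mul_one, add_zero, smul_zero]
    module
end

section
/- Let Ψ and Ξ be invertible n×n complex matrices, S a Hermitian n×n complex matrix, and J an n×n complex matrix with J†S = SJ. Assume S − Ψ†Ψ is invertible. Define H = ΨJΨ⁻¹, η = (Ψ⁻¹)†SΨ⁻¹, Σ = (Ξ⁻¹)†(S − Ψ†Ψ), H₁ = ηH, H₂ = (Ψ†)⁻¹Ξ†, and H₄ = −H₂†ΨΞ⁻¹ − (Σ†)⁻¹Ψ†H₂. Let H̃ be the 2n×2n block matrix [[H₁, H₂],[H₂†, H₄]], let Ψ̃ be the 2n×n block matrix with top block Ψ and bottom block Ξ, and let Φ̃ be the 2n×n block matrix with top block Ψ and bottom block Σ. Then H̃ is Hermitian, Φ̃†Ψ̃ = S, and Φ̃†H̃Ψ̃ = SJ. -/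
open Matrix

/-- The explicit construction in the proof of Theorem 1: given invertible
`Ψ, Ξ`, a Hermitian `S`, and `J` with `Jᴴ * S = S * J`, assuming `S - Ψᴴ * Ψ` invertible and
setting `H = Ψ * J * Ψ⁻¹`, `η = (Ψ⁻¹)ᴴ * S * Ψ⁻¹`, `Σ = (Ξ⁻¹)ᴴ * (S - Ψᴴ * Ψ)`, `H₁ = η * H`,
`H₂ = (Ψᴴ)⁻¹ * Ξᴴ`, `H₄ = -H₂ᴴ * Ψ * Ξ⁻¹ - (Σᴴ)⁻¹ * Ψᴴ * H₂`, the block matrix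
`H̃ = [[H₁, H₂], [H₂ᴴ, H₄]]` is Hermitian and satisfies `Φ̃ᴴ * Ψ̃ = S` and
`Φ̃ᴴ * H̃ * Ψ̃ = S * J`, where `Ψ̃ = fromRows Ψ Ξ` and `Φ̃ = fromRows Ψ Σ`. -/
theorem embedding_construction (n : ℕ)
    (Ψ Ξ S J : Matrix (Fin n) (Fin n) ℂ)
    (hΨ : IsUnit Ψ) (hΞ : IsUnit Ξ) (hS : S.IsHermitian) (hJS : Jᴴ * S = S * J)
    (hinv : IsUnit (S - Ψᴴ * Ψ))
    (H η Sgm H₁ H₂ H₄ : Matrix (Fin n) (Fin n) ℂ)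
    (hH : H = Ψ * J * Ψ⁻¹)
    (hη : η = (Ψ⁻¹)ᴴ * S * Ψ⁻¹)
    (hSgm : Sgm = (Ξ⁻¹)ᴴ * (S - Ψᴴ * Ψ))
    (hH₁ : H₁ = η * H)
    (hH₂ : H₂ = (Ψᴴ)⁻¹ * Ξᴴ)
    (hH₄ : H₄ = -(H₂ᴴ * Ψ * Ξ⁻¹) - (Sgmᴴ)⁻¹ * Ψᴴ * H₂)
    (Htil : Matrix (Fin n ⊕ Fin n) (Fin n ⊕ Fin n) ℂ)
    (hHtil : Htil = fromBlocks H₁ H₂ H₂ᴴ H₄) :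
    Htil.IsHermitian ∧
    (fromRows Ψ Sgm)ᴴ * fromRows Ψ Ξ = S ∧
    (fromRows Ψ Sgm)ᴴ * Htil * fromRows Ψ Ξ = S * J := by
  have hΨd := (Matrix.isUnit_iff_isUnit_det _).1 hΨ
  have hΞd := (Matrix.isUnit_iff_isUnit_det _).1 hΞ
  have hDd := (Matrix.isUnit_iff_isUnit_det _).1 hinv
  have a1 : Ψ⁻¹ * Ψ = 1 := Matrix.nonsing_inv_mul _ hΨd
  have b1 : Ξ⁻¹ * Ξ = 1 := Matrix.nonsing_inv_mul _ hΞd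
  have b2 : Ξ * Ξ⁻¹ = 1 := Matrix.mul_nonsing_inv _ hΞd
  have a3 : Ψᴴ * (Ψ⁻¹)ᴴ = 1 := by rw [← conjTranspose_mul, a1, conjTranspose_one]
  have hD : (S - Ψᴴ * Ψ)ᴴ = S - Ψᴴ * Ψ := by
    rw [conjTranspose_sub, conjTranspose_mul, conjTranspose_conjTranspose, hS.eq]
  have hSg : Sgmᴴ = (S - Ψᴴ * Ψ) * Ξ⁻¹ := by
    rw [hSgm, conjTranspose_mul, hD, conjTranspose_conjTranspose]
  have h2 : H₂ = (Ψ⁻¹)ᴴ * Ξᴴ := by rw [hH₂, conjTranspose_nonsing_inv]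
  have h2' : H₂ᴴ = Ξ * Ψ⁻¹ := by
    rw [h2, conjTranspose_mul, conjTranspose_conjTranspose, conjTranspose_conjTranspose]
  have h4 : H₄ = -1 - Ξ * (S - Ψᴴ * Ψ)⁻¹ * Ξᴴ := by
    have e1 : H₂ᴴ * Ψ * Ξ⁻¹ = 1 := by
      rw [h2', Matrix.mul_assoc Ξ, a1, Matrix.mul_one, b2]
    have e2 : (Sgmᴴ)⁻¹ = Ξ * (S - Ψᴴ * Ψ)⁻¹ := by
      rw [hSg, Matrix.mul_inv_rev, Matrix.nonsing_inv_nonsing_inv _ hΞd]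
    have e3 : Ψᴴ * H₂ = Ξᴴ := by
      rw [h2, ← Matrix.mul_assoc, a3, Matrix.one_mul]
    rw [hH₄, e1, e2, Matrix.mul_assoc _ Ψᴴ, e3]
  have h1 : H₁ = (Ψ⁻¹)ᴴ * (S * J) * Ψ⁻¹ := by
    rw [hH₁, hη, hH]
    calc (Ψ⁻¹)ᴴ * S * Ψ⁻¹ * (Ψ * J * Ψ⁻¹) = (Ψ⁻¹)ᴴ * S * (Ψ⁻¹ * Ψ) * J * Ψ⁻¹ := by
          simp only [Matrix.mul_assoc]
      _ = _ := by rw [a1]; simp only [Matrix.mul_assoc, Matrix.one_mul]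
  have hSJ : (S * J)ᴴ = S * J := by rw [conjTranspose_mul, hS.eq, hJS]
  refine ⟨?_, ?_, ?_⟩
  · rw [hHtil]
    refine Matrix.IsHermitian.fromBlocks ?_ rfl ?_
    · rw [h1, IsHermitian, conjTranspose_mul, conjTranspose_mul, hSJ,
        conjTranspose_conjTranspose]
      simp only [Matrix.mul_assoc]
    · rw [h4, IsHermitian, conjTranspose_sub, conjTranspose_mul, conjTranspose_mul,
        conjTranspose_nonsing_inv, hD, conjTranspose_conjTranspose, conjTranspose_neg,
        conjTranspose_one, Matrix.mul_assoc]
  · rw [conjTranspose_fromRows_eq_fromCols_conjTranspose, fromCols_mul_fromRows, hSg,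
      Matrix.mul_assoc, b1, Matrix.mul_one]
    abel
  · rw [hHtil, conjTranspose_fromRows_eq_fromCols_conjTranspose, fromCols_mul_fromBlocks,
      fromCols_mul_fromRows]
    have p1 : Ψᴴ * H₁ * Ψ = S * J := by
      calc Ψᴴ * H₁ * Ψ = (Ψᴴ * (Ψ⁻¹)ᴴ) * (S * J) * (Ψ⁻¹ * Ψ) := by
            rw [h1]; simp only [Matrix.mul_assoc]
        _ = _ := by rw [a1, a3, Matrix.one_mul, Matrix.mul_one]
    have p2 : Sgmᴴ * H₂ᴴ * Ψ = S - Ψᴴ * Ψ := by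
      calc Sgmᴴ * H₂ᴴ * Ψ = (S - Ψᴴ * Ψ) * (Ξ⁻¹ * Ξ) * (Ψ⁻¹ * Ψ) := by
            rw [hSg, h2']; simp only [Matrix.mul_assoc]
        _ = _ := by rw [a1, b1, Matrix.mul_one, Matrix.mul_one]
    have p3 : Ψᴴ * H₂ * Ξ = Ξᴴ * Ξ := by
      rw [h2, ← Matrix.mul_assoc, a3, Matrix.one_mul]
    have p4 : Sgmᴴ * H₄ * Ξ = -(S - Ψᴴ * Ψ) - Ξᴴ * Ξ := by
      rw [hSg, h4]
      have hd := Matrix.mul_nonsing_inv _ hDd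
      generalize S - Ψᴴ * Ψ = D at hd ⊢
      calc D * Ξ⁻¹ * (-1 - Ξ * D⁻¹ * Ξᴴ) * Ξ
          = -(D * (Ξ⁻¹ * Ξ)) - D * (Ξ⁻¹ * Ξ) * D⁻¹ * Ξᴴ * Ξ := by noncomm_ring
        _ = _ := by rw [b1, Matrix.mul_one, hd, Matrix.one_mul]
    rw [Matrix.add_mul, Matrix.add_mul, p1, p2, p3, p4]
    abel
end

section
/- Let r, s, θ be real numbers with Δ := s² − r²·sin²θ < 0, set u := √(−Δ) + r·sinθ, and assume u ≠ 0. Let H = [[r·e^{iθ}, s],[s, r·e^{−iθ}]] and Ψ = [[i·u, −s],[s, i·u]]. Then Ψ is invertible and Ψ⁻¹·H·Ψ = J, where J = diag(r·cosθ + i·√(−Δ), r·cosθ − i·√(−Δ)). -/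
open Matrix Complex

/-- In the broken regime `Δ = s² - r² sin²θ < 0`, with
`u = √(-Δ) + r sinθ ≠ 0`, the eigenvector matrix `Ψ = [[iu, -s], [s, iu]]` is invertible
and diagonalizes the Bender Hamiltonian: `Ψ⁻¹ * H * Ψ = diag(r cosθ + i√(-Δ),
r cosθ - i√(-Δ))`. -/
theorem bender_broken_diagonalization (r s θ : ℝ)
    (hΔ : s ^ 2 - r ^ 2 * Real.sin θ ^ 2 < 0)
    (hu : Real.sqrt (-(s ^ 2 - r ^ 2 * Real.sin θ ^ 2)) + r * Real.sin θ ≠ 0) :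
    IsUnit (!![Complex.I * (Real.sqrt (-(s ^ 2 - r ^ 2 * Real.sin θ ^ 2)) + r * Real.sin θ),
               -(s : ℂ);
               (s : ℂ),
               Complex.I * (Real.sqrt (-(s ^ 2 - r ^ 2 * Real.sin θ ^ 2)) + r * Real.sin θ)]
        : Matrix (Fin 2) (Fin 2) ℂ) ∧
    (!![Complex.I * (Real.sqrt (-(s ^ 2 - r ^ 2 * Real.sin θ ^ 2)) + r * Real.sin θ),
        -(s : ℂ);
        (s : ℂ),
        Complex.I * (Real.sqrt (-(s ^ 2 - r ^ 2 * Real.sin θ ^ 2)) + r * Real.sin θ)]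
        : Matrix (Fin 2) (Fin 2) ℂ)⁻¹
      * !![(r : ℂ) * Complex.exp (θ * Complex.I), (s : ℂ);
           (s : ℂ), (r : ℂ) * Complex.exp (-(θ * Complex.I))]
      * !![Complex.I * (Real.sqrt (-(s ^ 2 - r ^ 2 * Real.sin θ ^ 2)) + r * Real.sin θ),
           -(s : ℂ);
           (s : ℂ),
           Complex.I * (Real.sqrt (-(s ^ 2 - r ^ 2 * Real.sin θ ^ 2)) + r * Real.sin θ)]
      = !![(r : ℂ) * Real.cos θ
             + Complex.I * Real.sqrt (-(s ^ 2 - r ^ 2 * Real.sin θ ^ 2)), 0;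
           0, (r : ℂ) * Real.cos θ
             - Complex.I * Real.sqrt (-(s ^ 2 - r ^ 2 * Real.sin θ ^ 2))] := by
  have hw : 0 < Real.sqrt (-(s ^ 2 - r ^ 2 * Real.sin θ ^ 2)) :=
    Real.sqrt_pos.mpr (by linarith)
  have hsq : Real.sqrt (-(s ^ 2 - r ^ 2 * Real.sin θ ^ 2)) ^ 2
      = -(s ^ 2 - r ^ 2 * Real.sin θ ^ 2) := Real.sq_sqrt (by linarith)
  have he : Complex.exp (θ * Complex.I) = Real.cos θ + Real.sin θ * Complex.I := by
    rw [Complex.exp_mul_I, Complex.ofReal_cos, Complex.ofReal_sin]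
  have he' : Complex.exp (-(θ * Complex.I)) = Real.cos θ - Real.sin θ * Complex.I := by
    rw [← neg_mul, Complex.exp_mul_I, Complex.ofReal_cos, Complex.ofReal_sin,
      Complex.cos_neg, Complex.sin_neg]
    ring
  rw [he, he']
  generalize Real.sqrt (-(s ^ 2 - r ^ 2 * Real.sin θ ^ 2)) = w at *
  generalize Real.sin θ = y at *
  generalize Real.cos θ = c at *
  have hsqC : (w : ℂ) ^ 2 = -((s : ℂ) ^ 2 - (r : ℂ) ^ 2 * (y : ℂ) ^ 2) := by
    exact_mod_cast hsq
  have hwC : (w : ℂ) ≠ 0 := by exact_mod_cast hw.ne'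
  have huC : (w : ℂ) + r * y ≠ 0 := by exact_mod_cast hu
  have hI : Complex.I ^ 2 = -1 := Complex.I_sq
  have hdet : IsUnit (!![Complex.I * ((w : ℂ) + r * y), -(s : ℂ);
      (s : ℂ), Complex.I * ((w : ℂ) + r * y)] : Matrix (Fin 2) (Fin 2) ℂ).det := by
    rw [Matrix.det_fin_two_of, isUnit_iff_ne_zero]
    have : Complex.I * ((w : ℂ) + r * y) * (Complex.I * ((w : ℂ) + r * y)) - -(s : ℂ) * s
        = -2 * (w * (w + r * y)) := by
      linear_combination ((w : ℂ) + r * y) ^ 2 * hI + hsqC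
    rw [this]
    exact mul_ne_zero (by norm_num) (mul_ne_zero hwC huC)
  refine ⟨(Matrix.isUnit_iff_isUnit_det _).mpr hdet, ?_⟩
  rw [Matrix.mul_assoc]
  have key : (!![(r : ℂ) * (c + y * Complex.I), (s : ℂ);
        (s : ℂ), (r : ℂ) * (c - y * Complex.I)] : Matrix (Fin 2) (Fin 2) ℂ)
      * !![Complex.I * ((w : ℂ) + r * y), -(s : ℂ); (s : ℂ), Complex.I * ((w : ℂ) + r * y)]
      = !![Complex.I * ((w : ℂ) + r * y), -(s : ℂ); (s : ℂ), Complex.I * ((w : ℂ) + r * y)]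
      * !![(r : ℂ) * c + Complex.I * w, 0; 0, (r : ℂ) * c - Complex.I * w] := by
    rw [Matrix.mul_fin_two, Matrix.mul_fin_two]
    congr 1
    ext i j
    fin_cases i <;> fin_cases j <;> simp
    · linear_combination ((w : ℂ) + r * y) * (r * y - w) * hI + hsqC
    · ring
    · ring
    · linear_combination -((w : ℂ) + r * y) * (r * y - w) * hI - hsqC
  rw [key, Matrix.nonsing_inv_mul_cancel_left _ _ hdet]
end

section
/- Let E₀, s, θ be real numbers. Let H̃ be the 4×4 complex matrix [[E₀, s·cos²θ, i·s·cosθ·sinθ, 0],[s·cos²θ, E₀, 0, −i·s·cosθ·sinθ],[−i·s·cosθ·sinθ, 0, E₀, s·cos²θ],[0, i·s·cosθ·sinθ, s·cos²θ, E₀]], and let Ψ̃ be the 4×2 matrix with rows (e^{iθ/2}/2, i·e^{−iθ/2}/2), (e^{−iθ/2}/2, −i·e^{iθ/2}/2), (e^{−iθ/2}/2, i·e^{iθ/2}/2), (e^{iθ/2}/2, −i·e^{−iθ/2}/2). Then H̃ is Hermitian, Ψ̃†·Ψ̃ = I₂, and Ψ̃†·H̃·Ψ̃ = diag(E₀ +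 s·cosθ, E₀ − s·cosθ). -/
open Matrix Complex

/-- The Günther–Samsonov embedding: the explicit `4 × 4` Hamiltonian `H̃`
is Hermitian, the explicit `4 × 2` matrix `Ψ̃` satisfies `Ψ̃ᴴ * Ψ̃ = 1`, and
`Ψ̃ᴴ * H̃ * Ψ̃ = diag(E₀ + s cosθ, E₀ - s cosθ)`. -/
theorem gunther_samsonov_embedding (E₀ s θ : ℝ) :
    (!![(E₀ : ℂ), s * Real.cos θ ^ 2, Complex.I * s * Real.cos θ * Real.sin θ, 0;
        (s : ℂ) * Real.cos θ ^ 2, (E₀ : ℂ), 0, -(Complex.I * s * Real.cos θ * Real.sin θ);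
        -(Complex.I * s * Real.cos θ * Real.sin θ), 0, (E₀ : ℂ), (s : ℂ) * Real.cos θ ^ 2;
        0, Complex.I * s * Real.cos θ * Real.sin θ, (s : ℂ) * Real.cos θ ^ 2, (E₀ : ℂ)]
      : Matrix (Fin 4) (Fin 4) ℂ).IsHermitian ∧
    (!![Complex.exp (θ / 2 * Complex.I) / 2, Complex.I * Complex.exp (-(θ / 2 * Complex.I)) / 2;
        Complex.exp (-(θ / 2 * Complex.I)) / 2, -(Complex.I * Complex.exp (θ / 2 * Complex.I)) / 2;
        Complex.exp (-(θ / 2 * Complex.I)) / 2, Complex.I * Complex.exp (θ / 2 * Complex.I) / 2;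
        Complex.exp (θ / 2 * Complex.I) / 2, -(Complex.I * Complex.exp (-(θ / 2 * Complex.I))) / 2]
      : Matrix (Fin 4) (Fin 2) ℂ)ᴴ *
      !![Complex.exp (θ / 2 * Complex.I) / 2, Complex.I * Complex.exp (-(θ / 2 * Complex.I)) / 2;
        Complex.exp (-(θ / 2 * Complex.I)) / 2, -(Complex.I * Complex.exp (θ / 2 * Complex.I)) / 2;
        Complex.exp (-(θ / 2 * Complex.I)) / 2, Complex.I * Complex.exp (θ / 2 * Complex.I) / 2;
        Complex.exp (θ / 2 * Complex.I) / 2, -(Complex.I * Complex.exp (-(θ / 2 * Complex.I))) / 2]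
      = (1 : Matrix (Fin 2) (Fin 2) ℂ) ∧
    (!![Complex.exp (θ / 2 * Complex.I) / 2, Complex.I * Complex.exp (-(θ / 2 * Complex.I)) / 2;
        Complex.exp (-(θ / 2 * Complex.I)) / 2, -(Complex.I * Complex.exp (θ / 2 * Complex.I)) / 2;
        Complex.exp (-(θ / 2 * Complex.I)) / 2, Complex.I * Complex.exp (θ / 2 * Complex.I) / 2;
        Complex.exp (θ / 2 * Complex.I) / 2, -(Complex.I * Complex.exp (-(θ / 2 * Complex.I))) / 2]
      : Matrix (Fin 4) (Fin 2) ℂ)ᴴ *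
      !![(E₀ : ℂ), s * Real.cos θ ^ 2, Complex.I * s * Real.cos θ * Real.sin θ, 0;
        (s : ℂ) * Real.cos θ ^ 2, (E₀ : ℂ), 0, -(Complex.I * s * Real.cos θ * Real.sin θ);
        -(Complex.I * s * Real.cos θ * Real.sin θ), 0, (E₀ : ℂ), (s : ℂ) * Real.cos θ ^ 2;
        0, Complex.I * s * Real.cos θ * Real.sin θ, (s : ℂ) * Real.cos θ ^ 2, (E₀ : ℂ)] *
      !![Complex.exp (θ / 2 * Complex.I) / 2, Complex.I * Complex.exp (-(θ / 2 * Complex.I)) / 2;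
        Complex.exp (-(θ / 2 * Complex.I)) / 2, -(Complex.I * Complex.exp (θ / 2 * Complex.I)) / 2;
        Complex.exp (-(θ / 2 * Complex.I)) / 2, Complex.I * Complex.exp (θ / 2 * Complex.I) / 2;
        Complex.exp (θ / 2 * Complex.I) / 2, -(Complex.I * Complex.exp (-(θ / 2 * Complex.I))) / 2]
      = !![(E₀ : ℂ) + s * Real.cos θ, 0; 0, (E₀ : ℂ) - s * Real.cos θ] := by
  have h2 : (starRingEnd ℂ) 2 = 2 := Complex.conj_ofNat 2
  have hconj : (starRingEnd ℂ) (Complex.exp (θ / 2 * Complex.I))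
      = Complex.exp (-(θ / 2 * Complex.I)) := by
    rw [← Complex.exp_conj]
    simp [h2]
  have hconj2 : (starRingEnd ℂ) (Complex.exp (-(θ / 2 * Complex.I)))
      = Complex.exp (θ / 2 * Complex.I) := by
    rw [← hconj, Complex.conj_conj]
  have hab : Complex.exp (θ / 2 * Complex.I) * Complex.exp (-(θ / 2 * Complex.I)) = 1 := by
    rw [← Complex.exp_add]; simp
  have ha2 : Complex.exp (θ / 2 * Complex.I) ^ 2
      = (Real.cos θ : ℂ) + Real.sin θ * Complex.I := by
    rw [← Complex.exp_nat_mul, Complex.ofReal_cos, Complex.ofReal_sin, ← Complex.exp_mul_I]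
    congr 1; push_cast; ring
  have hb2 : Complex.exp (-(θ / 2 * Complex.I)) ^ 2
      = (Real.cos θ : ℂ) - Real.sin θ * Complex.I := by
    rw [← hconj, ← map_pow, ha2]
    simp only [map_add, map_mul, Complex.conj_ofReal, Complex.conj_I]; ring
  have hcs : (Real.cos θ : ℂ) ^ 2 + (Real.sin θ : ℂ) ^ 2 = 1 := by
    exact_mod_cast Real.cos_sq_add_sin_sq θ
  have hI : Complex.I ^ 2 = -1 := Complex.I_sq
  have hcc : (starRingEnd ℂ) (Real.cos θ : ℂ) = Real.cos θ := Complex.conj_ofReal _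
  have hss : (starRingEnd ℂ) (Real.sin θ : ℂ) = Real.sin θ := Complex.conj_ofReal _
  generalize Complex.exp (θ / 2 * Complex.I) = a at *
  generalize Complex.exp (-(θ / 2 * Complex.I)) = b at *
  generalize (Real.cos θ : ℂ) = c at *
  generalize (Real.sin θ : ℂ) = d at *
  refine ⟨?_, ?_, ?_⟩
  · ext i j
    fin_cases i <;> fin_cases j <;> simp [hcc, hss]
  · ext i j
    fin_cases i <;> fin_cases j <;>
      simp [Matrix.mul_apply, Fin.sum_univ_succ, hconj, hconj2, h2] <;> grind
  · ext i j
    fin_cases i <;> fin_cases j <;>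
      simp [Matrix.mul_apply, Fin.sum_univ_succ, hconj, hconj2, h2] <;> grind
end
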